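/- Let f_{3,15}(z) = (η(3z)η(5z))³ + (η(z)η(15z))³ for z in the upper half plane. Then for every real y > 0, f_{3,15}(i/(15y)) = 15^{3/2} y³ f_{3,15}(iy); this is the real-axis form of the Fricke relation f_{3,15}(z) = −f_{3,15}(−1/(15z))/((−15)^{3/2}z³). -/

import Mathlib

open scoped BigOperators Real

/-- The Dedekind eta function `η(z) = e^{πiz/12} ∏_{n≥1} (1 - e^{2πinz})`. -/
noncomputable def dedekindEta (z : ℂ) : ℂ :=
  Complex.exp (Real.pi * Complex.I * z / 12) *
    ∏' n : ℕ, (1 - Complex.exp (2 * Real.pi * Complex.I * ((n : ℂ) + 1) * z))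

/-- The weight-3 level-15 CM cusp form `f_{3,15}(z) = (η(3z)η(5z))³ + (η(z)η(15z))³`. -/
noncomputable def f315 (z : ℂ) : ℂ :=
  (dedekindEta (3 * z) * dedekindEta (5 * z)) ^ 3 +
    (dedekindEta z * dedekindEta (15 * z)) ^ 3

/-- `dedekindEta` agrees with Mathlib's eta function. -/
theorem dedekindEta_eq_eta (z : ℂ) : dedekindEta z = ModularForm.eta z := by
  simp only [dedekindEta, ModularForm.eta, ModularForm.eta_q_eq_cexp, Function.Periodic.qParam]
  congr 2
  push_cast
  ring

/-- The inversion formula for the eta function on the imaginary axis. -/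
theorem dedekindEta_I_div (t : ℝ) (ht : 0 < t) :
    dedekindEta (Complex.I / t) = (Real.sqrt t : ℂ) * dedekindEta (Complex.I * t) := by
  have htc : (t : ℂ) ≠ 0 := by exact_mod_cast ht.ne'
  have hmem : Complex.I * t ∈ UpperHalfPlane.upperHalfPlaneSet := by
    simpa [UpperHalfPlane.upperHalfPlaneSet] using ht
  have hinv : -1 / (Complex.I * t) = Complex.I / t := by
    field_simp
    simp
  have hsqrt : Complex.sqrt (Complex.I * t) = (Real.sqrt t : ℂ) * Complex.sqrt Complex.I := by
    rw [sqrt_eq_exp (mul_ne_zero Complex.I_ne_zero htc),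
      sqrt_eq_exp Complex.I_ne_zero, Complex.log_mul_ofReal t ht _ Complex.I_ne_zero,
      Real.sqrt_eq_rpow, Real.rpow_def_of_pos ht, Complex.ofReal_exp, ← Complex.exp_add]
    congr 1
    push_cast
    ring
  have hI : Complex.sqrt Complex.I ≠ 0 := by
    rw [sqrt_eq_exp Complex.I_ne_zero]
    exact Complex.exp_ne_zero _
  have h := ModularForm.eta_comp_eq_csqrt_I_inv hmem
  simp only [Function.comp_apply, Pi.smul_apply, Pi.mul_apply, smul_eq_mul, hinv, hsqrt] at h
  rw [dedekindEta_eq_eta, dedekindEta_eq_eta, h]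
  field_simp

/-- Real-axis form of the Fricke relation at level 15:
`f_{3,15}(i/(15y)) = 15^{3/2} y³ f_{3,15}(iy)` for every real `y > 0`. -/
theorem f315_fricke_real (y : ℝ) (hy : 0 < y) :
    f315 (Complex.I / (15 * (y : ℂ))) =
      (((15 : ℝ) ^ ((3 : ℝ) / 2) : ℝ) : ℂ) * ((y : ℂ)) ^ 3 * f315 (Complex.I * (y : ℂ)) := by
  have hyc : (y : ℂ) ≠ 0 := by exact_mod_cast hy.ne'
  have h1 := dedekindEta_I_div y hy
  have h3 := dedekindEta_I_div (3 * y) (by positivity)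
  have h5 := dedekindEta_I_div (5 * y) (by positivity)
  have h15 := dedekindEta_I_div (15 * y) (by positivity)
  push_cast at h3 h5 h15
  have e3 : 3 * (Complex.I / (15 * (y : ℂ))) = Complex.I / (5 * y) := by
    field_simp
    norm_num
  have e5 : 5 * (Complex.I / (15 * (y : ℂ))) = Complex.I / (3 * y) := by
    field_simp
    norm_num
  have e15 : 15 * (Complex.I / (15 * (y : ℂ))) = Complex.I / y := by
    field_simp
  have hpow : (15 : ℝ) ^ ((3 : ℝ) / 2) = √15 ^ 3 := by
    rw [Real.sqrt_eq_rpow, ← Real.rpow_natCast, ← Real.rpow_mul (by norm_num)]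
    norm_num
  have hs35 : ((√(5 * y) : ℝ) : ℂ) * (√(3 * y) : ℝ) = (√15 : ℝ) * y := by
    rw [← Complex.ofReal_mul, ← Complex.ofReal_mul, ← Real.sqrt_mul (by positivity),
      show 5 * y * (3 * y) = 15 * y ^ 2 by ring, Real.sqrt_mul (by norm_num),
      Real.sqrt_sq hy.le]
  have hs15 : ((√(15 * y) : ℝ) : ℂ) * (√y : ℝ) = (√15 : ℝ) * y := by
    rw [← Complex.ofReal_mul, ← Complex.ofReal_mul, ← Real.sqrt_mul (by positivity),
      show 15 * y * y = 15 * y ^ 2 by ring, Real.sqrt_mul (by norm_num),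
      Real.sqrt_sq hy.le]
  simp only [f315]
  rw [e3, e5, e15, h1, h3, h5, h15, hpow, Complex.ofReal_pow,
    mul_mul_mul_comm (√(5 * y) : ℂ), hs35, mul_mul_mul_comm (√(15 * y) : ℂ), hs15, mul_left_comm 3, mul_left_comm 5,
    mul_left_comm 15]
  ring
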